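/- Let F ⊆ ℤ² be a nonempty finite set and k : F → [0, ∞). Define the Hamiltonian H(φ) := −(1/2) ∑_{(x,y) ∈ F×F, |x−y|=1} φ_x φ_y + (1/2) ∑_{x ∈ F} (k_x + 4) φ_x² for φ ∈ ℝ^F, where the first sum is over ordered pairs of nearest neighbours in F. Then φ ↦ exp(−H(φ)) is integrable on ℝ^F with respect to Lebesgue measure, the series ∑_{m=1}^∞ trace(P^m)/m converges, and ∫_{ℝ^F} exp(−H(φ)) dφ = ∏_{x ∈ F} (2π/(k_x + 4))^{1/2} · exp( (1/2) ∑_{m=1}^∞ trace(P^m)/m ), where P is the killed random walk transition matrix on F. -/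

import Mathlib

open Matrix MeasureTheory Real

/-- The killed random walk transition matrix on a finite set `F ⊆ ℤ²` with killing rates `k`:
`P x y = 1/(k x + 4)` if `x` and `y` are nearest neighbours in `ℤ²`, and `0` otherwise. -/
noncomputable def killedRWMatrix (F : Finset (ℤ × ℤ)) (k : ℤ × ℤ → ℝ) : Matrix F F ℝ :=
  fun x y =>
    if ((x : ℤ × ℤ).1 - (y : ℤ × ℤ).1) ^ 2 + ((x : ℤ × ℤ).2 - (y : ℤ × ℤ).2) ^ 2 = 1 then
      1 / (k x + 4)
    else 0

/-- The discrete Gaussian free field Hamiltonian on `F ⊆ ℤ²` with killing rates `k` and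
Dirichlet boundary conditions:
`H(φ) = −(1/2) ∑_{x∼y} φ_x φ_y + (1/2) ∑_x (k_x + 4) φ_x²`,
the first sum being over ordered pairs of nearest neighbours in `F`. -/
noncomputable def gffHamiltonian (F : Finset (ℤ × ℤ)) (k : ℤ × ℤ → ℝ) (φ : F → ℝ) : ℝ :=
  -(1 / 2) * ∑ x : F, ∑ y : F,
      (if ((x : ℤ × ℤ).1 - (y : ℤ × ℤ).1) ^ 2 + ((x : ℤ × ℤ).2 - (y : ℤ × ℤ).2) ^ 2 = 1 then
        φ x * φ y else 0)
    + (1 / 2) * ∑ x : F, (k x + 4) * φ x ^ 2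

namespace Matrix.IsHermitian

variable {n : Type*} [Fintype n] [DecidableEq n] {A : Matrix n n ℝ}

theorem trace_pow_eq_sum_eigenvalues_pow (hA : A.IsHermitian) (m : ℕ) :
    (A ^ m).trace = ∑ i, hA.eigenvalues i ^ m := by
  conv_lhs => rw [hA.spectral_theorem, ← map_pow, Unitary.conjStarAlgAut_apply, trace_mul_cycle,
    Unitary.coe_star_mul_self, one_mul, diagonal_pow, trace_diagonal]
  simp

theorem det_one_sub (hA : A.IsHermitian) : (1 - A).det = ∏ i, (1 - hA.eigenvalues i) := by
  have h := eval_charpoly A 1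
  rw [hA.charpoly_eq] at h
  simpa [Polynomial.eval_prod] using h.symm

/-- The expansion `-log det (1 - A) = ∑ trace (A ^ m) / m` for a real symmetric matrix with
spectrum in `(-1, 1)`. -/
theorem hasSum_trace_pow_div (hA : A.IsHermitian) (h : ∀ i, |hA.eigenvalues i| < 1) :
    HasSum (fun m : ℕ+ => (A ^ (m : ℕ)).trace / ((m : ℕ) : ℝ)) (-Real.log (1 - A).det) := by
  have hlog : -Real.log (1 - A).det = ∑ i, -Real.log (1 - hA.eigenvalues i) := by
    rw [hA.det_one_sub, Real.log_prod, Finset.sum_neg_distrib]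
    intro i _
    linarith [(abs_lt.1 (h i)).2]
  rw [hlog, ← Equiv.pnatEquivNat.symm.hasSum_iff]
  convert hasSum_sum fun i (_ : i ∈ Finset.univ) =>
    Real.hasSum_pow_div_log_of_abs_lt_one (h i) using 2 with m
  simp [hA.trace_pow_eq_sum_eigenvalues_pow, Finset.sum_div]

theorem dotProduct_mulVec_eq_sum_eigenvalues (hA : A.IsHermitian) (x : n → ℝ) :
    x ⬝ᵥ A *ᵥ x =
      ∑ i, hA.eigenvalues i *
        (((star hA.eigenvectorUnitary : unitaryGroup n ℝ) : Matrix n n ℝ) *ᵥ x) i ^ 2 := by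
  conv_lhs => rw [hA.spectral_theorem, Unitary.conjStarAlgAut_apply, ← mulVec_mulVec,
    ← mulVec_mulVec, dotProduct_mulVec]
  rw [dotProduct]
  refine Finset.sum_congr rfl fun i _ => ?_
  rw [← mulVec_transpose, mulVec_diagonal]
  simp [star_eq_conjTranspose, conjTranspose_eq_transpose_of_trivial]
  ring

theorem exists_mulVec_eq_eigenvalues_smul (hA : A.IsHermitian) (i : n) :
    ∃ v ≠ 0, A *ᵥ v = hA.eigenvalues i • v :=
  ⟨hA.eigenvectorBasis i, fun h => hA.eigenvectorBasis.orthonormal.ne_zero i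
    (PiLp.ext fun x => congrFun h x), hA.mulVec_eigenvectorBasis i⟩

end Matrix.IsHermitian

section GaussianIntegral

theorem integrable_prod_exp_neg_mul_sq {n : Type*} [Fintype n] {b : n → ℝ} (hb : ∀ i, 0 < b i) :
    Integrable fun x : n → ℝ => ∏ i, Real.exp (-b i * x i ^ 2) :=
  Integrable.fintype_prod (f := fun i t => Real.exp (-b i * t ^ 2))
    fun i => integrable_exp_neg_mul_sq (hb i)

variable {n : Type*} [Fintype n] [DecidableEq n] {A : Matrix n n ℝ}

theorem Matrix.measurePreserving_mulVec_of_mem_unitaryGroup {U : Matrix n n ℝ}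
    (hU : U ∈ unitaryGroup n ℝ) : MeasurePreserving (fun x : n → ℝ => U *ᵥ x) := by
  have hdet : |U.det| = 1 := by
    have := Unitary.mul_star_self_of_mem (det_of_mem_unitary hU)
    rw [star_trivial] at this
    rw [← sq_eq_sq₀ (abs_nonneg _) zero_le_one, sq_abs, sq, this, one_pow]
  have hne : U.det ≠ 0 := by
    intro h
    simp [h] at hdet
  refine ⟨(toLin' U).continuous_of_finiteDimensional.measurable, ?_⟩
  have h := Real.map_matrix_volume_pi_eq_smul_volume_pi hne
  rw [abs_inv, hdet, inv_one, ENNReal.ofReal_one, one_smul] at h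
  exact h

theorem Matrix.IsHermitian.exp_neg_half_dotProduct_mulVec (hA : A.IsHermitian) (x : n → ℝ) :
    Real.exp (-(1 / 2 * (x ⬝ᵥ A *ᵥ x))) =
      ∏ i, Real.exp (-(hA.eigenvalues i / 2) *
        (((star hA.eigenvectorUnitary : unitaryGroup n ℝ) : Matrix n n ℝ) *ᵥ x) i ^ 2) := by
  rw [← Real.exp_sum, hA.dotProduct_mulVec_eq_sum_eigenvalues, Finset.mul_sum,
    ← Finset.sum_neg_distrib]
  congr 1
  refine Finset.sum_congr rfl fun i _ => ?_
  ring

theorem Matrix.PosDef.integrable_exp_neg_half_dotProduct_mulVec (hA : A.PosDef) :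
    Integrable fun x : n → ℝ => Real.exp (-(1 / 2 * (x ⬝ᵥ A *ᵥ x))) := by
  simp_rw [hA.1.exp_neg_half_dotProduct_mulVec]
  exact (measurePreserving_mulVec_of_mem_unitaryGroup
    (star hA.1.eigenvectorUnitary).2).integrable_comp_of_integrable
    (integrable_prod_exp_neg_mul_sq fun i => half_pos (hA.eigenvalues_pos i))

/-- The multivariate Gaussian integral. -/
theorem Matrix.PosDef.integral_exp_neg_half_dotProduct_mulVec (hA : A.PosDef) :
    ∫ x : n → ℝ, Real.exp (-(1 / 2 * (x ⬝ᵥ A *ᵥ x))) =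
      √((2 * π) ^ Fintype.card n / A.det) := by
  simp_rw [hA.1.exp_neg_half_dotProduct_mulVec]
  have hmp := measurePreserving_mulVec_of_mem_unitaryGroup (star hA.1.eigenvectorUnitary).2
  have hint := integrable_prod_exp_neg_mul_sq fun i => half_pos (hA.eigenvalues_pos i)
  have hmap := integral_map hmp.measurable.aemeasurable
    (hmp.map_eq.symm ▸ hint.aestronglyMeasurable)
  rw [hmp.map_eq] at hmap
  rw [← hmap, integral_fintype_prod_volume_eq_prod
    fun i (t : ℝ) => Real.exp (-(hA.1.eigenvalues i / 2) * t ^ 2)]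
  simp_rw [integral_gaussian]
  rw [← Real.sqrt_prod _ fun i _ => ?_, hA.1.det_eq_prod_eigenvalues]
  · congr 1
    rw [← Finset.card_univ, ← Finset.prod_const, RCLike.ofReal_real_eq_id]
    simp only [id, ← Finset.prod_div_distrib]
    refine Finset.prod_congr rfl fun i _ => ?_
    have := (hA.eigenvalues_pos i).ne'
    field_simp
  · have := hA.eigenvalues_pos i
    positivity

end GaussianIntegral

section KilledRandomWalk

/-- The adjacency matrix of the nearest neighbour graph on `F ⊆ ℤ²`. -/
def latticeAdjMatrix (F : Finset (ℤ × ℤ)) : Matrix F F ℝ :=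
  fun x y =>
    if ((x : ℤ × ℤ).1 - (y : ℤ × ℤ).1) ^ 2 + ((x : ℤ × ℤ).2 - (y : ℤ × ℤ).2) ^ 2 = 1 then 1 else 0

variable {F : Finset (ℤ × ℤ)} {k : ℤ × ℤ → ℝ}

theorem latticeAdjMatrix_comm (x y : F) : latticeAdjMatrix F x y = latticeAdjMatrix F y x := by
  simp only [latticeAdjMatrix, sub_sq_comm]

theorem mem_neighbours_of_sq_add_sq_eq_one {x y : ℤ × ℤ}
    (h : (x.1 - y.1) ^ 2 + (x.2 - y.2) ^ 2 = 1) :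
    y ∈ ({(x.1 + 1, x.2), (x.1 - 1, x.2), (x.1, x.2 + 1), (x.1, x.2 - 1)} :
      Finset (ℤ × ℤ)) := by
  obtain ⟨a, b⟩ := x
  obtain ⟨c, d⟩ := y
  simp only [Finset.mem_insert, Finset.mem_singleton, Prod.mk.injEq] at h ⊢
  have h1 : a - c ≤ 1 := by nlinarith [sq_nonneg (b - d)]
  have h2 : -1 ≤ a - c := by nlinarith [sq_nonneg (b - d)]
  have h3 : b - d ≤ 1 := by nlinarith [sq_nonneg (a - c)]
  have h4 : -1 ≤ b - d := by nlinarith [sq_nonneg (a - c)]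
  generalize hs : a - c = s at *
  generalize ht : b - d = t at *
  interval_cases s <;> interval_cases t <;> simp at h <;> omega

/-- Maximum principle: a function on a finite `F ⊆ ℤ²` which is dominated at each point by a quarter
of the absolute value of the sum over its neighbours in `F` vanishes. -/
theorem eq_zero_of_four_mul_abs_le_abs_latticeAdjMatrix_mulVec {v : F → ℝ}
    (h : ∀ x, 4 * |v x| ≤ |(latticeAdjMatrix F *ᵥ v) x|) : v = 0 := by
  by_contra hv
  obtain ⟨x₀, hx₀⟩ := Function.ne_iff.1 hv
  have hne : (Finset.univ : Finset F).Nonempty := ⟨x₀, Finset.mem_univ _⟩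
  obtain ⟨z, -, hz⟩ := Finset.exists_max_image Finset.univ (fun x => |v x|) hne
  obtain ⟨x, hxM, hx⟩ := Finset.exists_max_image (Finset.univ.filter fun x => |v x| = |v z|)
    (fun x : F => (x : ℤ × ℤ).1) ⟨z, by simp⟩
  replace hxM : |v x| = |v z| := by simpa using hxM
  have hpos : 0 < |v z| := (abs_pos.2 hx₀).trans_le (hz x₀ (Finset.mem_univ _))
  set w : ℤ × ℤ → ℝ := fun y => if hy : y ∈ F then |v ⟨y, hy⟩| else 0 with hw
  have hw0 (y) : 0 ≤ w y := by
    simp only [hw]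
    split_ifs <;> positivity
  have hwM (y) : w y ≤ |v z| := by
    simp only [hw]
    split_ifs with hy
    exacts [hz _ (Finset.mem_univ _), abs_nonneg _]
  have hright : w ((x : ℤ × ℤ).1 + 1, (x : ℤ × ℤ).2) < |v z| := by
    refine lt_of_le_of_ne (hwM _) fun heq => ?_
    simp only [hw] at heq
    split_ifs at heq with hy
    · have := hx ⟨_, hy⟩ (by simpa using heq)
      simp at this
    · exact hpos.ne heq
  have hsum : |(latticeAdjMatrix F *ᵥ v) x| ≤
      ∑ y ∈ {((x : ℤ × ℤ).1 + 1, (x : ℤ × ℤ).2), ((x : ℤ × ℤ).1 - 1, (x : ℤ × ℤ).2),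
        ((x : ℤ × ℤ).1, (x : ℤ × ℤ).2 + 1), ((x : ℤ × ℤ).1, (x : ℤ × ℤ).2 - 1)}, w y := by
    set N : Finset (ℤ × ℤ) := {((x : ℤ × ℤ).1 + 1, (x : ℤ × ℤ).2),
      ((x : ℤ × ℤ).1 - 1, (x : ℤ × ℤ).2), ((x : ℤ × ℤ).1, (x : ℤ × ℤ).2 + 1),
      ((x : ℤ × ℤ).1, (x : ℤ × ℤ).2 - 1)} with hN
    calc |(latticeAdjMatrix F *ᵥ v) x|
        ≤ ∑ y : F, |latticeAdjMatrix F x y * v y| := Finset.abs_sum_le_sum_abs _ _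
      _ ≤ ∑ y : F, if (y : ℤ × ℤ) ∈ N then w y else 0 := by
          refine Finset.sum_le_sum fun y _ => ?_
          by_cases hxy : ((x : ℤ × ℤ).1 - (y : ℤ × ℤ).1) ^ 2 +
              ((x : ℤ × ℤ).2 - (y : ℤ × ℤ).2) ^ 2 = 1
          · rw [if_pos (mem_neighbours_of_sq_add_sq_eq_one hxy)]
            simp [latticeAdjMatrix, hxy, hw]
          · simp only [latticeAdjMatrix, if_neg hxy, zero_mul, abs_zero]
            split_ifs
            exacts [hw0 _, le_rfl]
      _ = ∑ y ∈ F, if y ∈ N then w y else 0 :=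
          Finset.sum_coe_sort F fun y => if y ∈ N then w y else 0
      _ = ∑ y ∈ F ∩ N, w y := by rw [Finset.sum_ite_mem]
      _ ≤ ∑ y ∈ N, w y :=
          Finset.sum_le_sum_of_subset_of_nonneg Finset.inter_subset_right fun y _ _ => hw0 y
  rw [Finset.sum_insert (by simp; omega), Finset.sum_insert (by simp),
    Finset.sum_insert (by simp; omega), Finset.sum_singleton] at hsum
  linarith [h x, hwM ((x : ℤ × ℤ).1 - 1, (x : ℤ × ℤ).2),
    hwM ((x : ℤ × ℤ).1, (x : ℤ × ℤ).2 + 1), hwM ((x : ℤ × ℤ).1, (x : ℤ × ℤ).2 - 1)]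

theorem eq_zero_of_latticeAdjMatrix_mulVec_eq {v c : F → ℝ} (hc : ∀ x, 4 ≤ |c x|)
    (h : ∀ x, (latticeAdjMatrix F *ᵥ v) x = c x * v x) : v = 0 :=
  eq_zero_of_four_mul_abs_le_abs_latticeAdjMatrix_mulVec fun x => by
    rw [h, abs_mul]
    exact mul_le_mul_of_nonneg_right (hc x) (abs_nonneg _)

/-- The matrix of the massive Dirichlet Laplacian on `F`. -/
noncomputable def massiveLaplacian (F : Finset (ℤ × ℤ)) (k : ℤ × ℤ → ℝ) : Matrix F F ℝ :=
  diagonal (fun x : F => k x + 4) - latticeAdjMatrix F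

theorem massiveLaplacian_posDef (hk : ∀ x ∈ F, 0 ≤ k x) : (massiveLaplacian F k).PosDef := by
  have hH : (massiveLaplacian F k).IsHermitian :=
    (isHermitian_diagonal _).sub (IsHermitian.ext fun x y => by
      simpa using latticeAdjMatrix_comm y x)
  refine hH.posDef_iff_eigenvalues_pos.2 fun i => ?_
  obtain ⟨v, hv0, hv⟩ := hH.exists_mulVec_eq_eigenvalues_smul i
  by_contra! hi
  refine hv0 (eq_zero_of_latticeAdjMatrix_mulVec_eq
    (c := fun x => k x + 4 - hH.eigenvalues i) (fun x => ?_) fun x => ?_)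
  · exact le_abs.2 (Or.inl (by linarith [hk x x.2]))
  · generalize hH.eigenvalues i = l at hv ⊢
    have := congrFun hv x
    rw [massiveLaplacian, sub_mulVec, Pi.sub_apply, mulVec_diagonal, Pi.smul_apply,
      smul_eq_mul] at this
    linarith

theorem gffHamiltonian_eq (φ : F → ℝ) :
    gffHamiltonian F k φ = 1 / 2 * (φ ⬝ᵥ massiveLaplacian F k *ᵥ φ) := by
  have h1 : φ ⬝ᵥ diagonal (fun x : F => k x + 4) *ᵥ φ = ∑ x : F, (k x + 4) * φ x ^ 2 :=
    Finset.sum_congr rfl fun x _ => by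
      rw [mulVec_diagonal]
      ring
  have h2 : φ ⬝ᵥ latticeAdjMatrix F *ᵥ φ = ∑ x : F, ∑ y : F,
      (if ((x : ℤ × ℤ).1 - (y : ℤ × ℤ).1) ^ 2 + ((x : ℤ × ℤ).2 - (y : ℤ × ℤ).2) ^ 2 = 1 then
        φ x * φ y else 0) :=
    Finset.sum_congr rfl fun x _ => by
      rw [mulVec, dotProduct, Finset.mul_sum]
      refine Finset.sum_congr rfl fun y _ => ?_
      simp [latticeAdjMatrix]
  rw [massiveLaplacian, sub_mulVec, dotProduct_sub, h1, h2, gffHamiltonian]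
  ring

/-- The symmetrization of the killed random walk transition matrix. -/
noncomputable def symmKilledRWMatrix (F : Finset (ℤ × ℤ)) (k : ℤ × ℤ → ℝ) : Matrix F F ℝ :=
  diagonal (fun x : F => (√(k x + 4))⁻¹) * latticeAdjMatrix F *
    diagonal (fun x : F => (√(k x + 4))⁻¹)

theorem symmKilledRWMatrix_isHermitian : (symmKilledRWMatrix F k).IsHermitian :=
  IsHermitian.ext fun x y => by
    simp only [symmKilledRWMatrix, mul_diagonal, diagonal_mul, star_trivial,
      latticeAdjMatrix_comm y x]
    ring

theorem diagonal_sqrt_mul_diagonal_inv_sqrt (hk : ∀ x ∈ F, 0 ≤ k x) :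
    diagonal (fun x : F => √(k x + 4)) * diagonal (fun x : F => (√(k x + 4))⁻¹) = 1 := by
  rw [diagonal_mul_diagonal, ← diagonal_one]
  congr 1
  funext x
  exact mul_inv_cancel₀ (Real.sqrt_pos.2 (by linarith [hk x x.2])).ne'

theorem killedRWMatrix_eq_conj (hk : ∀ x ∈ F, 0 ≤ k x) :
    killedRWMatrix F k = diagonal (fun x : F => (√(k x + 4))⁻¹) * symmKilledRWMatrix F k *
      diagonal (fun x : F => √(k x + 4)) := by
  ext x y
  have hx : 0 < k x + 4 := by linarith [hk x x.2]
  have hy : √(k y + 4) ≠ 0 := (Real.sqrt_pos.2 (by linarith [hk y y.2])).ne'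
  have hxx : (√(k x + 4))⁻¹ * (√(k x + 4))⁻¹ = 1 / (k x + 4) := by
    rw [← mul_inv, Real.mul_self_sqrt hx.le, one_div]
  simp only [symmKilledRWMatrix, mul_diagonal, diagonal_mul]
  rw [← mul_assoc, ← mul_assoc, hxx, inv_mul_cancel_right₀ hy]
  simp [latticeAdjMatrix, killedRWMatrix]

theorem trace_killedRWMatrix_pow (hk : ∀ x ∈ F, 0 ≤ k x) (m : ℕ) :
    (killedRWMatrix F k ^ m).trace = (symmKilledRWMatrix F k ^ m).trace := by
  let u : (Matrix F F ℝ)ˣ := ⟨_, _, diagonal_sqrt_mul_diagonal_inv_sqrt hk,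
    mul_eq_one_comm.1 (diagonal_sqrt_mul_diagonal_inv_sqrt hk)⟩
  have h : killedRWMatrix F k = (↑u⁻¹ : Matrix F F ℝ) * symmKilledRWMatrix F k * u :=
    killedRWMatrix_eq_conj hk
  rw [h, Units.conj_pow', trace_units_conj']

theorem abs_eigenvalues_symmKilledRWMatrix_lt_one (hk : ∀ x ∈ F, 0 ≤ k x) (i : F) :
    |(symmKilledRWMatrix_isHermitian (F := F) (k := k)).eigenvalues i| < 1 := by
  set hS := symmKilledRWMatrix_isHermitian (F := F) (k := k)
  obtain ⟨v, hv0, hv⟩ := hS.exists_mulVec_eq_eigenvalues_smul i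
  by_contra! hi
  have hpos (x : F) : 0 < √(k x + 4) := Real.sqrt_pos.2 (by linarith [hk x x.2])
  have hzero := eq_zero_of_latticeAdjMatrix_mulVec_eq
    (v := diagonal (fun x : F => (√(k x + 4))⁻¹) *ᵥ v)
    (c := fun x => hS.eigenvalues i * (k x + 4)) (fun x => ?_) fun x => ?_
  · refine hv0 (funext fun x => ?_)
    have := congrFun hzero x
    simpa [mulVec_diagonal, (hpos x).ne'] using this
  · have hx : 4 ≤ |k x + 4| := le_abs.2 (Or.inl (by linarith [hk x x.2]))
    rw [abs_mul]
    nlinarith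
  · generalize hS.eigenvalues i = l at hv ⊢
    have := congrFun hv x
    rw [symmKilledRWMatrix, ← mulVec_mulVec, ← mulVec_mulVec, mulVec_diagonal,
      inv_mul_eq_iff_eq_mul₀ (hpos x).ne'] at this
    rw [this, mulVec_diagonal, Pi.smul_apply, smul_eq_mul]
    have hsq : k x + 4 = √(k x + 4) * √(k x + 4) :=
      (Real.mul_self_sqrt (by linarith [hk x x.2])).symm
    nth_rw 2 [hsq]
    have := (hpos x).ne'
    field_simp

theorem det_massiveLaplacian (hk : ∀ x ∈ F, 0 ≤ k x) :
    (massiveLaplacian F k).det = (∏ x : F, (k x + 4)) * (1 - symmKilledRWMatrix F k).det := by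
  have h : massiveLaplacian F k = diagonal (fun x : F => √(k x + 4)) *
      (1 - symmKilledRWMatrix F k) * diagonal (fun x : F => √(k x + 4)) := by
    have h1 := diagonal_sqrt_mul_diagonal_inv_sqrt hk
    have h2 := mul_eq_one_comm.1 h1
    rw [mul_sub, sub_mul, mul_one, diagonal_mul_diagonal, massiveLaplacian, symmKilledRWMatrix,
      mul_assoc, mul_assoc, mul_assoc, h2, mul_one, ← mul_assoc, h1, one_mul]
    congr 2
    funext x
    exact (Real.mul_self_sqrt (by linarith [hk x x.2])).symm
  rw [h, det_mul, det_mul, det_diagonal, mul_right_comm, ← Finset.prod_mul_distrib]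
  congr 1
  exact Finset.prod_congr rfl fun x _ => Real.mul_self_sqrt (by linarith [hk x x.2])

theorem hasSum_trace_killedRWMatrix_pow_div (hk : ∀ x ∈ F, 0 ≤ k x) :
    HasSum (fun m : ℕ+ => (killedRWMatrix F k ^ (m : ℕ)).trace / ((m : ℕ) : ℝ))
      (-Real.log (1 - symmKilledRWMatrix F k).det) := by
  simp_rw [trace_killedRWMatrix_pow hk]
  exact symmKilledRWMatrix_isHermitian.hasSum_trace_pow_div
    (abs_eigenvalues_symmKilledRWMatrix_lt_one hk)

theorem det_one_sub_symmKilledRWMatrix_pos (hk : ∀ x ∈ F, 0 ≤ k x) :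
    0 < (1 - symmKilledRWMatrix F k).det := by
  rw [symmKilledRWMatrix_isHermitian.det_one_sub]
  exact Finset.prod_pos fun i _ => by
    linarith [(abs_lt.1 (abs_eigenvalues_symmKilledRWMatrix_lt_one hk i)).2]

end KilledRandomWalk


/-- The Gaussian free field partition function on a nonempty finite `F ⊆ ℤ²` with killing
rates `k : F → [0,∞)` equals `∏_{x∈F} (2π/(k_x+4))^{1/2} · exp((1/2) ∑_{m≥1} trace(Pᵐ)/m)`,
where `P` is the killed random walk transition matrix on `F`; moreover `exp(−H)` is
integrable and the trace series converges. -/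
theorem gff_partition_function (F : Finset (ℤ × ℤ)) (hF : F.Nonempty)
    (k : ℤ × ℤ → ℝ) (hk : ∀ x ∈ F, 0 ≤ k x) :
    Integrable (fun φ : F → ℝ => Real.exp (-(gffHamiltonian F k φ))) volume ∧
    Summable (fun m : ℕ+ => Matrix.trace ((killedRWMatrix F k) ^ (m : ℕ)) / ((m : ℕ) : ℝ)) ∧
    ∫ φ : F → ℝ, Real.exp (-(gffHamiltonian F k φ)) =
      (∏ x : F, Real.sqrt (2 * π / (k x + 4))) *
        Real.exp ((1 / 2) *
          ∑' m : ℕ+, Matrix.trace ((killedRWMatrix F k) ^ (m : ℕ)) / ((m : ℕ) : ℝ)) := by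
  have hM := massiveLaplacian_posDef hk
  have hsum := hasSum_trace_killedRWMatrix_pow_div hk
  have hdet := det_one_sub_symmKilledRWMatrix_pos hk
  simp_rw [gffHamiltonian_eq]
  refine ⟨hM.integrable_exp_neg_half_dotProduct_mulVec, hsum.summable, ?_⟩
  have hd (x : F) : 0 < k x + 4 := by linarith [hk x x.2]
  have hexp : Real.exp (1 / 2 * -Real.log (1 - symmKilledRWMatrix F k).det) =
      √((1 - symmKilledRWMatrix F k).det)⁻¹ := by
    rw [← Real.log_inv, one_div, inv_mul_eq_div, Real.exp_half, Real.exp_log (inv_pos.2 hdet)]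
  rw [hM.integral_exp_neg_half_dotProduct_mulVec, hsum.tsum_eq, hexp, det_massiveLaplacian hk,
    ← Real.sqrt_prod _ fun x _ => by have := hd x; positivity,
    ← Real.sqrt_mul (Finset.prod_nonneg fun x _ => by have := hd x; positivity),
    Finset.prod_div_distrib, Finset.prod_const, Finset.card_univ, ← div_eq_mul_inv, div_div]
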